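/- arXiv:2404.14369 — 5 statements merged into one kernel-verified Lean document; each statement's English description precedes it below -/
import Mathlib

section
/- For all integers n ≥ ℓ ≥ 1, we have c n · c (ℓ+1) − c (n+1) · c ℓ = c (n−ℓ+1). -/
/-- Fix an integer `r` and the sequence `c : ℕ → ℤ` with `c 0 = -1`, `c 1 = 0`,
`c (n+1) = r * c n - c (n-1)` for `n ≥ 1`.  For all integers `n ≥ ℓ ≥ 1` we have
`c n * c (ℓ+1) - c (n+1) * c ℓ = c (n - ℓ + 1)`. -/
theorem c_mul_c_sub_c_mul_c_eq_c_sub (r : ℤ) (c : ℕ → ℤ)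
    (hc0 : c 0 = -1) (hc1 : c 1 = 0)
    (hcrec : ∀ n, 1 ≤ n → c (n + 1) = r * c n - c (n - 1))
    (n ℓ : ℕ) (hℓ : 1 ≤ ℓ) (hn : ℓ ≤ n) :
    c n * c (ℓ + 1) - c (n + 1) * c ℓ = c (n - ℓ + 1) := by
  have hrec (m : ℕ) : c (m + 2) = r * c (m + 1) - c m := hcrec (m + 1) (by omega)
  obtain ⟨k, rfl⟩ := Nat.exists_eq_add_of_le' hn
  rw [Nat.add_sub_cancel]
  clear hℓ hn
  induction ℓ with
  | zero => simp [hc0, hc1]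
  | succ m ih =>
    rw [← ih, ← add_assoc, hrec m, hrec (k + m)]
    ring
end

section
/- For all integers n ≥ ℓ ≥ 1, we have c (n+1) · c (ℓ+1) − c n · c ℓ = c (n+ℓ). -/
/-- Fix an integer `r` and the sequence `c : ℕ → ℤ` with `c 0 = -1`, `c 1 = 0`,
`c (n+1) = r * c n - c (n-1)` for `n ≥ 1`.  For all integers `n ≥ ℓ ≥ 1` we have
`c (n+1) * c (ℓ+1) - c n * c ℓ = c (n + ℓ)`. -/
theorem c_mul_c_sub_c_mul_c_eq_c_add (r : ℤ) (c : ℕ → ℤ)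
    (hc0 : c 0 = -1) (hc1 : c 1 = 0)
    (hcrec : ∀ n, 1 ≤ n → c (n + 1) = r * c n - c (n - 1))
    (n ℓ : ℕ) (hℓ : 1 ≤ ℓ) (hn : ℓ ≤ n) :
    c (n + 1) * c (ℓ + 1) - c n * c ℓ = c (n + ℓ) := by
  have hrec (m : ℕ) : c (m + 2) = r * c (m + 1) - c m := hcrec (m + 1) (by omega)
  clear hℓ hn
  induction ℓ generalizing n with
  | zero => simp [hc0, hc1]
  | succ k ih =>
    have h := ih (n + 1)
    rw [show n + 1 + k = n + (k + 1) by ring] at h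
    rw [← h, hrec n, hrec k]
    ring
end

section
/- For all nonnegative integers n, p, r with p ≥ r, and for every polynomial P with rational coefficients of degree strictly less than r, we have Σ_{k=0}^{p} (−1)^k · C(n−1−r, p−k) · P(k) · C(n−2r+k−1, k) = 0 (an identity in ℚ). -/
/-- The generalized binomial coefficient `C(A,B) = A(A-1)⋯(A-B+1)/B!` for `A : ℚ`
and `B : ℕ`. -/
def genChoose (A : ℚ) (B : ℕ) : ℚ :=
  (∏ i ∈ Finset.range B, (A - i)) / (B.factorial : ℚ)

theorem genChoose_eq_ringChoose (A : ℚ) (B : ℕ) : genChoose A B = Ring.choose A B := by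
  rw [Ring.choose_eq_smul, genChoose, ← descPochhammer_eval_eq_prod_range,
    ← Polynomial.aeval_eq_smeval, ← Polynomial.eval_map_algebraMap, descPochhammer_map,
    smul_eq_mul, div_eq_inv_mul]

/-- Upper negation: `(-1)^k C(x+k-1, k) = C(-x, k)`. -/
theorem neg_one_pow_mul_genChoose (x : ℚ) (k : ℕ) :
    (-1) ^ k * genChoose (x + k - 1) k = genChoose (-x) k := by
  rw [genChoose_eq_ringChoose, genChoose_eq_ringChoose, Ring.choose_neg, Int.negOnePow_def]
  simp [Units.smul_def]

theorem succ_mul_genChoose_succ (x : ℚ) (k : ℕ) :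
    ((k : ℚ) + 1) * genChoose x (k + 1) = x * genChoose (x - 1) k := by
  have hprod : ∏ i ∈ Finset.range k, (x - ((i + 1 : ℕ) : ℚ)) =
      ∏ i ∈ Finset.range k, (x - 1 - i) :=
    Finset.prod_congr rfl fun i _ => by push_cast; ring
  rw [genChoose, genChoose, Finset.prod_range_succ', hprod, Nat.factorial_succ]
  push_cast
  field_simp
  ring

theorem sum_genChoose_mul_genChoose (x y : ℚ) (p : ℕ) :
    ∑ k ∈ Finset.range (p + 1), genChoose x k * genChoose y (p - k) = genChoose (x + y) p := by
  simp only [genChoose_eq_ringChoose]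
  rw [Ring.add_choose_eq p (Commute.all x y),
    Finset.Nat.sum_antidiagonal_eq_sum_range_succ_mk]

/-- The weighted Vandermonde convolution vanishes for polynomial weights of degree at most
the total `x + y`, when that total is a natural number less than `p`. -/
theorem sum_genChoose_mul_eval_eq_zero (r : ℕ) : ∀ (p : ℕ) (x y : ℚ) (P : Polynomial ℚ),
    r ≤ p → x + y = r - 1 → P.degree < r →
    ∑ k ∈ Finset.range (p + 1), P.eval (k : ℚ) * (genChoose x k * genChoose y (p - k)) = 0 := by
  induction r with
  | zero =>
    intro p x y P _ _ hP
    have hP0 : P = 0 := by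
      rw [← Polynomial.degree_eq_bot]
      simpa using hP
    simp [hP0]
  | succ r ih =>
    intro p x y P hp hxy hP
    obtain ⟨p, rfl⟩ : ∃ q, p = q + 1 := ⟨p - 1, by omega⟩
    have hxy' : x + y = (r : ℚ) := by rw [hxy]; push_cast; ring
    have heval (t : ℚ) : P.eval t = t * P.divX.eval t + P.coeff 0 := by
      conv_lhs => rw [← P.divX_mul_X_add, Polynomial.eval_add, Polynomial.eval_mul_X,
        Polynomial.eval_C, mul_comm]
    have hconst : ∑ k ∈ Finset.range (p + 1 + 1),
        P.coeff 0 * (genChoose x k * genChoose y (p + 1 - k)) = 0 := by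
      rw [← Finset.mul_sum, sum_genChoose_mul_genChoose, hxy', genChoose_eq_ringChoose,
        Ring.choose_natCast, Nat.choose_eq_zero_of_lt (by omega), Nat.cast_zero, mul_zero]
    have hdeg : (Polynomial.taylor 1 P.divX).degree < (r : ℕ) := by
      rw [Polynomial.degree_taylor]
      rw [Polynomial.degree_lt_iff_coeff_zero] at hP ⊢
      exact fun m hm => by rw [Polynomial.coeff_divX, hP _ (by omega)]
    have hshift := ih p (x - 1) y (Polynomial.taylor 1 P.divX) (by omega)
      (by linarith) hdeg
    simp only [heval, add_mul, Finset.sum_add_distrib]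
    rw [hconst, add_zero, Finset.sum_range_succ']
    simp only [Nat.cast_zero, zero_mul, add_zero]
    rw [← mul_zero x, ← hshift, Finset.mul_sum]
    refine Finset.sum_congr rfl fun k _ => ?_
    rw [Polynomial.taylor_eval, Nat.add_sub_add_right]
    push_cast
    linear_combination
      P.divX.eval ((k : ℚ) + 1) * genChoose y (p - k) * succ_mul_genChoose_succ x k

/-- For all nonnegative integers `n, p, r` with `p ≥ r`, and every polynomial `P` over `ℚ`
of degree strictly less than `r`, we have
`Σ_{k=0}^{p} (−1)^k · C(n−1−r, p−k) · P(k) · C(n−2r+k−1, k) = 0`. -/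
theorem alternating_sum_genChoose_eq_zero (n p r : ℕ) (hpr : r ≤ p)
    (P : Polynomial ℚ) (hP : P.degree < (r : ℕ)) :
    ∑ k ∈ Finset.range (p + 1),
      (-1 : ℚ) ^ k * genChoose ((n : ℚ) - 1 - r) (p - k) * P.eval (k : ℚ) *
        genChoose ((n : ℚ) - 2 * r + k - 1) k = 0 := by
  rw [← sum_genChoose_mul_eval_eq_zero r p (-((n : ℚ) - 2 * r)) ((n : ℚ) - 1 - r) P hpr
    (by ring) hP]
  refine Finset.sum_congr rfl fun k _ => ?_
  rw [← neg_one_pow_mul_genChoose]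
  ring
end

section
/- Fix an integer r ≥ 3 and nonnegative integers α, β with (α,β) ≠ (0,0). For n ≥ 2 let P_n be the maximal Dyck path P(α·c(n+1) + β·c n, α·c n + β·c(n−1)), and let CP_+(P_n) ⊆ CP(P_n) be the set of positive compatible pairs on P_n, i.e. those (S_1,S_2) with r·|S_2| ≤ α·c(n+1) + β·c n. Then the real sequence |CP_+(P_n)| / |CP(P_n)| tends to 1 as n → ∞. -/
namespace CPwork

/-! ## The maximal Dyck path `P(ℓ,h)`

The maximal Dyck path `P(ℓ,h)` is the lattice path from `(0,0)` to `(ℓ,h)` of unit east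
and north steps never passing strictly above the main diagonal which is pointwise highest;
concretely, immediately after its `i`-th east step the path has taken exactly `⌊i·h/ℓ⌋`
north steps.  We encode the path by recording, for each edge, its (1-based) position in
the sequence of `ℓ + h` steps.  Horizontal (east) edges are labelled `η_1, …, η_ℓ` from
left to right and vertical (north) edges `ν_1, …, ν_h` from bottom to top.  The lattice
points of the path are `w_0, …, w_{ℓ+h}`, where `w_k` is the point reached after `k` steps.
-/

/-- The number of north steps taken immediately after (equivalently, immediately before)
the `i`-th east step of `P(ℓ,h)`, namely `⌊i·h/ℓ⌋`. -/
def northBefore (ℓ h i : ℕ) : ℕ := i * h / ℓ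

/-- The number of east steps preceding the `j`-th north step of `P(ℓ,h)`. -/
def eastBefore (ℓ h j : ℕ) : ℕ :=
  ((Finset.Icc 1 ℓ).filter fun i => northBefore ℓ h i < j).card

/-- The (1-based) position of the horizontal edge `η_i` in the step sequence of `P(ℓ,h)`. -/
def posE (ℓ h i : ℕ) : ℕ := i + northBefore ℓ h i

/-- The (1-based) position of the vertical edge `ν_j` in the step sequence of `P(ℓ,h)`. -/
def posN (ℓ h j : ℕ) : ℕ := j + eastBefore ℓ h j

/-- The index of the lattice point `p_{η_i}` (the left endpoint of `η_i`). -/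
def pE (ℓ h i : ℕ) : ℕ := posE ℓ h i - 1

/-- The index of the lattice point `p_{ν_j}` (the top endpoint of `ν_j`). -/
def pN (ℓ h j : ℕ) : ℕ := posN ℓ h j

/-- The positions of the edges of the subpath `→ w_a w_b` of `P(ℓ,h)` proceeding east
from the lattice point `w_a` to the lattice point `w_b`, continuing cyclically around
the path if `a > b`. -/
def steps (ℓ h a b : ℕ) : Finset ℕ :=
  if a ≤ b then Finset.Icc (a + 1) b
  else Finset.Icc (a + 1) (ℓ + h) ∪ Finset.Icc 1 b

/-- The indices of the lattice points of the subpath `→ w_a w_b`. -/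
def pts (ℓ h a b : ℕ) : Finset ℕ :=
  if a ≤ b then Finset.Icc a b
  else Finset.Icc a (ℓ + h) ∪ Finset.Icc 0 b

/-- The number of horizontal edges of `P(ℓ,h)` whose position lies in `E`. -/
def hIn (ℓ h : ℕ) (E : Finset ℕ) : ℕ :=
  ((Finset.Icc 1 ℓ).filter fun i => posE ℓ h i ∈ E).card

/-- The number of vertical edges of `P(ℓ,h)` whose position lies in `E`. -/
def vIn (ℓ h : ℕ) (E : Finset ℕ) : ℕ :=
  ((Finset.Icc 1 h).filter fun j => posN ℓ h j ∈ E).card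

/-- The number of horizontal edges of `S1` whose position lies in `E`. -/
def hInS (ℓ h : ℕ) (S1 E : Finset ℕ) : ℕ :=
  (S1.filter fun i => posE ℓ h i ∈ E).card

/-- The number of vertical edges of `S2` whose position lies in `E`. -/
def vInS (ℓ h : ℕ) (S2 E : Finset ℕ) : ℕ :=
  (S2.filter fun j => posN ℓ h j ∈ E).card

/-- A pair `(S1, S2)` of a set `S1` of (indices of) horizontal edges and a set `S2`
of (indices of) vertical edges of `P(ℓ,h)` is *compatible* if for every `η_i ∈ S1`
and `ν_j ∈ S2` there is a lattice point `t = w_m ≠ p_{η_i}, p_{ν_j}` on the subpath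
`→ p_{η_i} p_{ν_j}` with `|t p_{ν_j}|_1 = r·|→ t p_{ν_j} ∩ S2|` or
`|p_{η_i} t|_2 = r·|→ p_{η_i} t ∩ S1|`. -/
def Compatible (r : ℤ) (ℓ h : ℕ) (S1 S2 : Finset ℕ) : Prop :=
  S1 ⊆ Finset.Icc 1 ℓ ∧ S2 ⊆ Finset.Icc 1 h ∧
  ∀ i ∈ S1, ∀ j ∈ S2,
    ∃ m ∈ pts ℓ h (pE ℓ h i) (pN ℓ h j),
      m ≠ pE ℓ h i ∧ m ≠ pN ℓ h j ∧
      ((hIn ℓ h (steps ℓ h m (pN ℓ h j)) : ℤ)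
          = r * (vInS ℓ h S2 (steps ℓ h m (pN ℓ h j)) : ℤ) ∨
        (vIn ℓ h (steps ℓ h (pE ℓ h i) m) : ℤ)
          = r * (hInS ℓ h S1 (steps ℓ h (pE ℓ h i) m) : ℤ))

open scoped Classical in
/-- `CP r ℓ h` is the set of all compatible pairs on the maximal Dyck path `P(ℓ,h)`. -/
noncomputable def CP (r : ℤ) (ℓ h : ℕ) : Finset (Finset ℕ × Finset ℕ) :=
  ((Finset.Icc 1 ℓ).powerset ×ˢ (Finset.Icc 1 h).powerset).filter fun p =>
    Compatible r ℓ h p.1 p.2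

/-- `CPab r ℓ h a b` is the set of compatible pairs `(S1,S2)` on `P(ℓ,h)` with
`|S1| = a` and `|S2| = b`; it is empty if `a < 0` or `b < 0`. -/
noncomputable def CPab (r : ℤ) (ℓ h : ℕ) (a b : ℤ) : Finset (Finset ℕ × Finset ℕ) :=
  (CP r ℓ h).filter fun p => (p.1.card : ℤ) = a ∧ (p.2.card : ℤ) = b

end CPwork

namespace CPwork

/-! ## Counting edges along prefixes of the path -/

lemma card_filter_mem_Icc_add (S : Finset ℕ) (f : ℕ → ℕ) {a b : ℕ} (hab : a ≤ b) :
    (S.filter fun i => f i ∈ Finset.Icc 1 b).card =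
      (S.filter fun i => f i ∈ Finset.Icc 1 a).card +
        (S.filter fun i => f i ∈ Finset.Icc (a + 1) b).card := by
  rw [← Finset.card_union_of_disjoint]
  · congr 1
    ext i
    simp only [Finset.mem_filter, Finset.mem_union, Finset.mem_Icc]
    grind
  · rw [Finset.disjoint_left]
    intro i
    simp only [Finset.mem_filter, Finset.mem_Icc]
    grind

lemma card_filter_mem_steps_of_le (S : Finset ℕ) (f : ℕ → ℕ) (ℓ h : ℕ) {a b : ℕ}
    (hab : a ≤ b) :
    ((S.filter fun i => f i ∈ steps ℓ h a b).card : ℤ) =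
      (S.filter fun i => f i ∈ Finset.Icc 1 b).card -
        (S.filter fun i => f i ∈ Finset.Icc 1 a).card := by
  rw [steps, if_pos hab, card_filter_mem_Icc_add S f hab]
  push_cast
  ring

lemma card_filter_mem_steps_of_lt (S : Finset ℕ) (f : ℕ → ℕ) (ℓ h : ℕ) {a b : ℕ}
    (hba : b < a) (ha : a ≤ ℓ + h) :
    ((S.filter fun i => f i ∈ steps ℓ h a b).card : ℤ) =
      (S.filter fun i => f i ∈ Finset.Icc 1 (ℓ + h)).card -
        (S.filter fun i => f i ∈ Finset.Icc 1 a).card +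
        (S.filter fun i => f i ∈ Finset.Icc 1 b).card := by
  have hsplit : (S.filter fun i => f i ∈ steps ℓ h a b).card =
      (S.filter fun i => f i ∈ Finset.Icc (a + 1) (ℓ + h)).card +
        (S.filter fun i => f i ∈ Finset.Icc 1 b).card := by
    rw [steps, if_neg (by omega), ← Finset.card_union_of_disjoint]
    · congr 1
      ext i
      simp only [Finset.mem_filter, Finset.mem_union]
      grind
    · rw [Finset.disjoint_left]
      intro i
      simp only [Finset.mem_filter, Finset.mem_Icc]
      grind
  rw [hsplit, card_filter_mem_Icc_add S f ha]
  push_cast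
  ring

lemma card_filter_mem_Icc_mono (S : Finset ℕ) (f : ℕ → ℕ) {a b : ℕ} (hab : a ≤ b) :
    (S.filter fun i => f i ∈ Finset.Icc 1 a).card ≤
      (S.filter fun i => f i ∈ Finset.Icc 1 b).card := by
  rw [card_filter_mem_Icc_add S f hab]
  omega

lemma exists_eq_of_card_filter_lt (S : Finset ℕ) (f : ℕ → ℕ) {a : ℕ}
    (hlt : (S.filter fun i => f i ∈ Finset.Icc 1 a).card <
      (S.filter fun i => f i ∈ Finset.Icc 1 (a + 1)).card) :
    ∃ i ∈ S, f i = a + 1 := by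
  rw [card_filter_mem_Icc_add S f (a.le_add_right 1)] at hlt
  obtain ⟨i, hi⟩ := Finset.card_pos.mp (show 0 <
    (S.filter fun i => f i ∈ Finset.Icc (a + 1) (a + 1)).card by omega)
  simp only [Finset.mem_filter, Finset.mem_Icc] at hi
  exact ⟨i, hi.1, by omega⟩

lemma posN_mem_Icc {ℓ h j : ℕ} (hj : j ∈ Finset.Icc 1 h) :
    posN ℓ h j ∈ Finset.Icc 1 (ℓ + h) := by
  have hle : eastBefore ℓ h j ≤ ℓ := by
    simpa [eastBefore] using Finset.card_filter_le (Finset.Icc 1 ℓ) (northBefore ℓ h · < j)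
  simp only [Finset.mem_Icc, posN] at hj ⊢
  omega

lemma posE_mem_Icc {ℓ h i : ℕ} (hi : i ∈ Finset.Icc 1 ℓ) :
    posE ℓ h i ∈ Finset.Icc 1 (ℓ + h) := by
  simp only [Finset.mem_Icc, posE, northBefore] at hi ⊢
  have hle : i * h / ℓ ≤ h :=
    Nat.div_le_of_le_mul (Nat.mul_le_mul_right h hi.2)
  exact ⟨hi.1.trans (Nat.le_add_right _ _), add_le_add hi.2 hle⟩

lemma le_of_mem_pts {ℓ h a b m : ℕ} (hm : m ∈ pts ℓ h a b) (hb : b ≤ ℓ + h) :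
    m ≤ ℓ + h := by
  rw [pts] at hm
  split_ifs at hm <;> simp only [Finset.mem_union, Finset.mem_Icc] at hm <;> omega

/-! ## The excess of a set of edges along the path -/

/-- `r` times the number of edges of `S2` minus the number of horizontal edges,
among the first `k` edges of the path. -/
def verticalExcess (r : ℤ) (ℓ h : ℕ) (S2 : Finset ℕ) (k : ℕ) : ℤ :=
  r * vInS ℓ h S2 (Finset.Icc 1 k) - hIn ℓ h (Finset.Icc 1 k)

/-- `r` times the number of edges of `S1` minus the number of vertical edges,
among the first `k` edges of the path. -/
def horizontalExcess (r : ℤ) (ℓ h : ℕ) (S1 : Finset ℕ) (k : ℕ) : ℤ :=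
  r * hInS ℓ h S1 (Finset.Icc 1 k) - vIn ℓ h (Finset.Icc 1 k)

section Excess

variable {r : ℤ} {ℓ h : ℕ} {S1 S2 : Finset ℕ}

lemma verticalExcess_zero : verticalExcess r ℓ h S2 0 = 0 := by
  simp [verticalExcess, vInS, hIn]

lemma horizontalExcess_zero : horizontalExcess r ℓ h S1 0 = 0 := by
  simp [horizontalExcess, hInS, vIn]

lemma verticalExcess_steps_of_le {a b : ℕ} (hab : a ≤ b) :
    r * vInS ℓ h S2 (steps ℓ h a b) - hIn ℓ h (steps ℓ h a b) =
      verticalExcess r ℓ h S2 b - verticalExcess r ℓ h S2 a := by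
  simp only [verticalExcess, vInS, hIn, card_filter_mem_steps_of_le _ _ ℓ h hab]
  ring

lemma verticalExcess_steps_of_lt {a b : ℕ} (hba : b < a) (ha : a ≤ ℓ + h) :
    r * vInS ℓ h S2 (steps ℓ h a b) - hIn ℓ h (steps ℓ h a b) =
      verticalExcess r ℓ h S2 (ℓ + h) - verticalExcess r ℓ h S2 a +
        verticalExcess r ℓ h S2 b := by
  simp only [verticalExcess, vInS, hIn, card_filter_mem_steps_of_lt _ _ ℓ h hba ha]
  ring

lemma horizontalExcess_steps_of_le {a b : ℕ} (hab : a ≤ b) :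
    r * hInS ℓ h S1 (steps ℓ h a b) - vIn ℓ h (steps ℓ h a b) =
      horizontalExcess r ℓ h S1 b - horizontalExcess r ℓ h S1 a := by
  simp only [horizontalExcess, hInS, vIn, card_filter_mem_steps_of_le _ _ ℓ h hab]
  ring

lemma horizontalExcess_steps_of_lt {a b : ℕ} (hba : b < a) (ha : a ≤ ℓ + h) :
    r * hInS ℓ h S1 (steps ℓ h a b) - vIn ℓ h (steps ℓ h a b) =
      horizontalExcess r ℓ h S1 (ℓ + h) - horizontalExcess r ℓ h S1 a +
        horizontalExcess r ℓ h S1 b := by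
  simp only [horizontalExcess, hInS, vIn, card_filter_mem_steps_of_lt _ _ ℓ h hba ha]
  ring

lemma exists_posN_eq_of_verticalExcess_lt (hr : 0 ≤ r) {a : ℕ}
    (hlt : verticalExcess r ℓ h S2 a < verticalExcess r ℓ h S2 (a + 1)) :
    ∃ j ∈ S2, posN ℓ h j = a + 1 := by
  apply exists_eq_of_card_filter_lt
  by_contra! hle
  have hmono := card_filter_mem_Icc_mono (Finset.Icc 1 ℓ) (posE ℓ h) (Nat.le_succ a)
  have hmul := mul_le_mul_of_nonneg_left (Int.ofNat_le.mpr hle) hr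
  simp only [verticalExcess, vInS, hIn] at hlt
  simp only [Nat.succ_eq_add_one] at hmono
  omega

lemma exists_posE_eq_of_horizontalExcess_lt (hr : 0 ≤ r) {a : ℕ}
    (hlt : horizontalExcess r ℓ h S1 a < horizontalExcess r ℓ h S1 (a + 1)) :
    ∃ i ∈ S1, posE ℓ h i = a + 1 := by
  apply exists_eq_of_card_filter_lt
  by_contra! hle
  have hmono := card_filter_mem_Icc_mono (Finset.Icc 1 h) (posN ℓ h) (Nat.le_succ a)
  have hmul := mul_le_mul_of_nonneg_left (Int.ofNat_le.mpr hle) hr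
  simp only [horizontalExcess, hInS, vIn] at hlt
  simp only [Nat.succ_eq_add_one] at hmono
  omega

lemma le_verticalExcess_total (hS2 : S2 ⊆ Finset.Icc 1 h) :
    r * S2.card - ℓ ≤ verticalExcess r ℓ h S2 (ℓ + h) := by
  have hcard : vInS ℓ h S2 (Finset.Icc 1 (ℓ + h)) = S2.card := by
    rw [vInS, Finset.filter_true_of_mem fun j hj => posN_mem_Icc (hS2 hj)]
  have hle : hIn ℓ h (Finset.Icc 1 (ℓ + h)) ≤ ℓ := by
    simpa [hIn] using
      Finset.card_filter_le (Finset.Icc 1 ℓ) (posE ℓ h · ∈ Finset.Icc 1 (ℓ + h))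
  rw [verticalExcess, hcard]
  omega

lemma le_horizontalExcess_total (hS1 : S1 ⊆ Finset.Icc 1 ℓ) :
    r * S1.card - h ≤ horizontalExcess r ℓ h S1 (ℓ + h) := by
  have hcard : hInS ℓ h S1 (Finset.Icc 1 (ℓ + h)) = S1.card := by
    rw [hInS, Finset.filter_true_of_mem fun i hi => posE_mem_Icc (hS1 hi)]
  have hle : vIn ℓ h (Finset.Icc 1 (ℓ + h)) ≤ h := by
    simpa [vIn] using
      Finset.card_filter_le (Finset.Icc 1 h) (posN ℓ h · ∈ Finset.Icc 1 (ℓ + h))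
  rw [horizontalExcess, hcard]
  omega

/-- If `S2` is so large that its shadow is the whole path, then every horizontal edge `η`
is followed by a vertical edge of `S2` whose local shadow contains `η`. -/
lemma exists_vertical_edge_shadowing (hr : 0 ≤ r)
    (hpos : 0 < verticalExcess r ℓ h S2 (ℓ + h)) {a : ℕ} (ha : a ≤ ℓ + h) :
    ∃ j ∈ S2, ∀ m ∈ pts ℓ h a (posN ℓ h j), m ≠ a → m ≠ posN ℓ h j →
      (hIn ℓ h (steps ℓ h m (posN ℓ h j)) : ℤ) ≠
        r * vInS ℓ h S2 (steps ℓ h m (posN ℓ h j)) := by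
  set W := verticalExcess r ℓ h S2 with hW
  by_cases hex : ∃ b, a < b ∧ b ≤ ℓ + h ∧ W a < W b
  · classical
    obtain ⟨hab, hbL, hWb⟩ := Nat.find_spec hex
    have hmin : ∀ t, a ≤ t → t < Nat.find hex → W t ≤ W a := by
      intro t hat htb
      have := Nat.find_min hex htb
      rcases hat.eq_or_lt with rfl | hat
      · exact le_rfl
      · by_contra! hlt
        exact this ⟨hat, by omega, hlt⟩
    generalize Nat.find hex = b at *
    obtain ⟨b, rfl⟩ : ∃ k, b = k + 1 := ⟨b - 1, by omega⟩
    obtain ⟨j, hj, hjb⟩ := exists_posN_eq_of_verticalExcess_lt (S2 := S2) (ℓ := ℓ) (h := h)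
      hr (a := b) ((hmin b (by omega) (by omega)).trans_lt hWb)
    refine ⟨j, hj, ?_⟩
    rw [hjb]
    intro m hm hma hmb heq
    rw [pts, if_pos hab.le, Finset.mem_Icc] at hm
    have hsteps := verticalExcess_steps_of_le (r := r) (ℓ := ℓ) (h := h) (S2 := S2) hm.2
    have := hmin m hm.1 (by omega)
    rw [← hW] at hsteps
    linarith
  · push Not at hex
    have hend : W (ℓ + h) ≤ W a := by
      rcases ha.eq_or_lt with rfl | hlt
      · exact le_rfl
      · exact hex _ hlt le_rfl
    have hex' : ∃ b, b ≤ a ∧ 0 < W (ℓ + h) - W a + W b := ⟨a, le_rfl, by linarith⟩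
    classical
    obtain ⟨hba, hWb⟩ := Nat.find_spec hex'
    have hmin : ∀ t, t < Nat.find hex' → W (ℓ + h) - W a + W t ≤ 0 := by
      intro t htb
      by_contra! hlt
      exact Nat.find_min hex' htb ⟨by omega, hlt⟩
    generalize Nat.find hex' = b at *
    have hW0 : W 0 = 0 := verticalExcess_zero
    have hb0 : b ≠ 0 := by
      rintro rfl
      linarith
    obtain ⟨b, rfl⟩ : ∃ k, b = k + 1 := ⟨b - 1, by omega⟩
    obtain ⟨j, hj, hjb⟩ := exists_posN_eq_of_verticalExcess_lt (S2 := S2) (ℓ := ℓ) (h := h)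
      hr (a := b) (by
        rw [← hW]
        linarith [hmin b (by omega)])
    refine ⟨j, hj, ?_⟩
    rw [hjb]
    intro m hm hma hmb heq
    rcases hba.eq_or_lt with rfl | hba
    · simp [pts] at hm
      exact hma hm
    rw [pts, if_neg (by omega), Finset.mem_union, Finset.mem_Icc, Finset.mem_Icc] at hm
    rcases hm with hm | hm
    · have hsteps := verticalExcess_steps_of_lt (r := r) (ℓ := ℓ) (h := h) (S2 := S2)
        (show b + 1 < m by omega) hm.2
      have := hex m (by omega) hm.2
      rw [← hW] at hsteps
      linarith
    · have hsteps := verticalExcess_steps_of_le (r := r) (ℓ := ℓ) (h := h) (S2 := S2) hm.2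
      have := hmin m (by omega)
      rw [← hW] at hsteps
      linarith

/-- A compatible pair with `r·|S2| > ℓ` satisfies `r·|S1| ≤ h`. -/
theorem Compatible.mul_card_le (hr : 0 ≤ r) (hcomp : Compatible r ℓ h S1 S2)
    (hS2 : (ℓ : ℤ) < r * S2.card) : r * S1.card ≤ h := by
  obtain ⟨hsub1, hsub2, hcomp⟩ := hcomp
  by_contra! hlt
  have hVL := (sub_pos.mpr hlt).trans_le (le_horizontalExcess_total (r := r) hsub1)
  have hWL := (sub_pos.mpr hS2).trans_le (le_verticalExcess_total (r := r) hsub2)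
  set V := horizontalExcess r ℓ h S1 with hV
  obtain ⟨μ, hμ, hμmin⟩ :=
    Finset.exists_min_image (Finset.range (ℓ + h + 1)) V ⟨0, by simp⟩
  have hV0 : V 0 = 0 := horizontalExcess_zero
  -- the last point at which the excess is minimal
  obtain ⟨a, ha, hamax⟩ := Finset.exists_max_image
    ((Finset.range (ℓ + h + 1)).filter fun k => V k = V μ) id ⟨μ, by simp [hμ]⟩
  simp only [Finset.mem_filter, Finset.mem_range, id] at ha hamax hμmin
  have haL : a ≠ ℓ + h := by
    rintro rfl
    have := hμmin 0 (by omega)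
    rw [← ha.2] at this
    linarith
  have hstep : V a < V (a + 1) := by
    refine lt_of_le_of_ne (ha.2 ▸ hμmin (a + 1) (by omega)) fun heq => ?_
    have := hamax (a + 1) ⟨by omega, heq ▸ ha.2⟩
    omega
  obtain ⟨i, hi, hia⟩ := exists_posE_eq_of_horizontalExcess_lt hr hstep
  obtain ⟨j, hj, hshadow⟩ := exists_vertical_edge_shadowing (S2 := S2) hr hWL
    (show a ≤ ℓ + h by omega)
  have hpE : pE ℓ h i = a := by rw [pE, hia, Nat.add_sub_cancel]
  obtain ⟨m, hm, hma, hmb, heq⟩ := hcomp i hi j hj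
  rw [hpE] at hm hma heq
  have heq := heq.resolve_left (hshadow m hm hma hmb)
  have hmL : m ≤ ℓ + h :=
    le_of_mem_pts hm (Finset.mem_Icc.mp (posN_mem_Icc (ℓ := ℓ) (hsub2 hj))).2
  rcases lt_or_gt_of_ne hma with hlt' | hgt
  · have hsteps := horizontalExcess_steps_of_lt (r := r) (ℓ := ℓ) (h := h) (S1 := S1)
      hlt' (by omega)
    have := hμmin m (by omega)
    rw [← hV] at hsteps
    linarith [ha.2]
  · have hsteps := horizontalExcess_steps_of_le (r := r) (ℓ := ℓ) (h := h) (S1 := S1) hgt.le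
    rw [← hV] at hsteps
    have := hamax m ⟨by omega, by linarith [ha.2]⟩
    omega

end Excess

/-! ## Counting compatible pairs -/

lemma two_pow_le_card_CP (r : ℤ) (ℓ h : ℕ) : 2 ^ ℓ ≤ (CP r ℓ h).card := by
  have hsub : (Finset.Icc 1 ℓ).powerset ×ˢ {∅} ⊆ CP r ℓ h := by
    intro p hp
    simp only [Finset.mem_product, Finset.mem_powerset, Finset.mem_singleton] at hp
    simp only [CP, Finset.mem_filter, Finset.mem_product, Finset.mem_powerset]
    exact ⟨⟨hp.1, by simp [hp.2]⟩, hp.1, by simp [hp.2], by simp [hp.2]⟩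
  simpa using Finset.card_le_card hsub

lemma card_small_subsets_le (ℓ h : ℕ) :
    (((Finset.Icc 1 ℓ).powerset.filter fun S => 3 * S.card ≤ h).card : ℝ) ≤
      2 ^ h * (9 / 8) ^ ℓ := by
  calc (((Finset.Icc 1 ℓ).powerset.filter fun S => 3 * S.card ≤ h).card : ℝ)
      = ∑ S ∈ (Finset.Icc 1 ℓ).powerset.filter fun S => 3 * S.card ≤ h, (1 : ℝ) := by simp
    _ ≤ ∑ S ∈ (Finset.Icc 1 ℓ).powerset.filter fun S => 3 * S.card ≤ h,
          2 ^ h * (1 / 8 : ℝ) ^ S.card := by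
        refine Finset.sum_le_sum fun S hS => ?_
        have hle : (2 : ℝ) ^ (3 * S.card) ≤ 2 ^ h :=
          pow_le_pow_right₀ (by norm_num) (Finset.mem_filter.mp hS).2
        rw [pow_mul] at hle
        norm_num at hle
        rw [one_div, inv_pow, ← div_eq_mul_inv, le_div_iff₀ (by positivity)]
        simpa using hle
    _ ≤ ∑ S ∈ (Finset.Icc 1 ℓ).powerset, 2 ^ h * (1 / 8 : ℝ) ^ S.card :=
        Finset.sum_le_sum_of_subset_of_nonneg (Finset.filter_subset _ _)
          fun _ _ _ => by positivity
    _ = 2 ^ h * (9 / 8) ^ ℓ := by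
        have := Finset.sum_pow_mul_eq_add_pow (1 / 8 : ℝ) 1 (Finset.Icc 1 ℓ)
        norm_num at this
        rw [← Finset.mul_sum]
        norm_num [this]

lemma card_nonpositive_le {r : ℤ} (hr : 3 ≤ r) (ℓ h : ℕ) :
    (((CP r ℓ h).filter fun p => ¬ r * (p.2.card : ℤ) ≤ ℓ).card : ℝ) ≤
      4 ^ h * (9 / 8) ^ ℓ := by
  have hsub : ((CP r ℓ h).filter fun p => ¬ r * (p.2.card : ℤ) ≤ ℓ) ⊆
      ((Finset.Icc 1 ℓ).powerset.filter fun S => 3 * S.card ≤ h) ×ˢ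
        (Finset.Icc 1 h).powerset := by
    intro p hp
    simp only [CP, Finset.mem_filter, Finset.mem_product, Finset.mem_powerset, not_le] at hp
    simp only [Finset.mem_filter, Finset.mem_product, Finset.mem_powerset]
    have hle := hp.1.2.mul_card_le (by omega) hp.2
    have hmul := mul_le_mul_of_nonneg_right hr (Nat.cast_nonneg (α := ℤ) p.1.card)
    exact ⟨⟨hp.1.1.1, by omega⟩, hp.1.1.2⟩
  have hcard := Finset.card_le_card hsub
  rw [Finset.card_product, Finset.card_powerset, Nat.card_Icc, Nat.add_sub_cancel] at hcard
  calc _ ≤ (((Finset.Icc 1 ℓ).powerset.filter fun S => 3 * S.card ≤ h).card : ℝ) * 2 ^ h := by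
        exact_mod_cast hcard
    _ ≤ 2 ^ h * (9 / 8) ^ ℓ * 2 ^ h := by
        gcongr
        exact card_small_subsets_le ℓ h
    _ = 4 ^ h * (9 / 8) ^ ℓ := by
        rw [show (4 : ℝ) = 2 * 2 by norm_num, mul_pow]
        ring

/-- When `5h ≤ 2ℓ`, the proportion of positive compatible pairs on `P(ℓ,h)` is at least
`1 - (243/256)^h`. -/
lemma one_sub_pow_le_ratio {r : ℤ} (hr : 3 ≤ r) {ℓ h : ℕ} (hℓ : 5 * h ≤ 2 * ℓ) :
    1 - (243 / 256 : ℝ) ^ h ≤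
      (((CP r ℓ h).filter fun p => r * (p.2.card : ℤ) ≤ ℓ).card : ℝ) / (CP r ℓ h).card := by
  have htotal : (2 : ℝ) ^ ℓ ≤ (CP r ℓ h).card := by exact_mod_cast two_pow_le_card_CP r ℓ h
  have hcard : (0 : ℝ) < (CP r ℓ h).card := lt_of_lt_of_le (by positivity) htotal
  have hsplit : (((CP r ℓ h).filter fun p => r * (p.2.card : ℤ) ≤ ℓ).card : ℝ) +
      ((CP r ℓ h).filter fun p => ¬ r * (p.2.card : ℤ) ≤ ℓ).card = (CP r ℓ h).card := by
    exact_mod_cast Finset.card_filter_add_card_filter_not _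
  have hbound : (4 : ℝ) ^ h * (9 / 8) ^ ℓ ≤ (243 / 256) ^ h * 2 ^ ℓ := by
    have hpow : (3 / 4 : ℝ) ^ (2 * ℓ) ≤ (3 / 4) ^ (5 * h) :=
      pow_le_pow_of_le_one (by norm_num) (by norm_num) hℓ
    calc (4 : ℝ) ^ h * (9 / 8) ^ ℓ = 4 ^ h * (3 / 4) ^ (2 * ℓ) * 2 ^ ℓ := by
          rw [pow_mul, mul_assoc, ← mul_pow]
          norm_num
      _ ≤ 4 ^ h * (3 / 4) ^ (5 * h) * 2 ^ ℓ := by gcongr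
      _ = (243 / 256) ^ h * 2 ^ ℓ := by
          rw [pow_mul, ← mul_pow]
          norm_num
  have hneg := card_nonpositive_le hr ℓ h
  rw [le_div_iff₀ hcard]
  have := mul_le_mul_of_nonneg_left htotal (show (0 : ℝ) ≤ (243 / 256) ^ h by positivity)
  linarith

/-! ## Growth of the sequence `c` -/

lemma growth_of_recurrence {r : ℤ} (hr : 3 ≤ r) {c : ℕ → ℤ} (hc0 : c 0 = -1) (hc1 : c 1 = 0)
    (hcrec : ∀ n, 1 ≤ n → c (n + 1) = r * c n - c (n - 1)) (n : ℕ) :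
    (n : ℤ) ≤ c (n + 1) ∧ 5 * c (n + 1) ≤ 2 * c (n + 2) ∧ c (n + 1) + 1 ≤ c (n + 2) := by
  induction n with
  | zero =>
    have := hcrec 1 le_rfl
    simp only [Nat.sub_self, hc0, hc1] at this
    simp [hc1, this]
  | succ n ih =>
    obtain ⟨hle, hratio, hstep⟩ := ih
    have hrec : c (n + 3) = r * c (n + 2) - c (n + 1) := hcrec (n + 2) (by omega)
    have hmul := mul_le_mul_of_nonneg_right hr (show 0 ≤ c (n + 2) by omega)
    rw [show n + 1 + 1 = n + 2 from rfl, show n + 1 + 2 = n + 3 from rfl]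
    push_cast
    omega

end CPwork

open CPwork in
/-- Fix `r ≥ 3` and nonnegative integers `α, β`, not both zero.  For `n ≥ 2`, let
`P_n = P(α·c(n+1) + β·c n, α·c n + β·c(n−1))` be the maximal Dyck path corresponding to
the cluster monomial `X_n^α X_{n+1}^β`, and let `CP₊(P_n)` be the set of positive
compatible pairs on `P_n`, i.e. those with `r·|S₂| ≤ α·c(n+1) + β·c n`.  Then
`|CP₊(P_n)| / |CP(P_n)| → 1` as `n → ∞`. -/
theorem positive_compatible_pairs_ratio_tendsto_one
    (r : ℤ) (hr : 3 ≤ r) (c : ℕ → ℤ)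
    (hc0 : c 0 = -1) (hc1 : c 1 = 0)
    (hcrec : ∀ n, 1 ≤ n → c (n + 1) = r * c n - c (n - 1))
    (α β : ℕ) (hαβ : (α, β) ≠ (0, 0)) :
    Filter.Tendsto
      (fun n : ℕ =>
        (((CP r ((α * c (n + 1) + β * c n).toNat) ((α * c n + β * c (n - 1)).toNat)).filter
            (fun p => (r * (p.2.card : ℤ)) ≤ α * c (n + 1) + β * c n)).card : ℝ) /
          ((CP r ((α * c (n + 1) + β * c n).toNat) ((α * c n + β * c (n - 1)).toNat)).card : ℝ))
      Filter.atTop (nhds 1) := by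
  have hgrowth : ∀ n : ℕ, 1 ≤ n → (n : ℤ) - 1 ≤ c n ∧ 5 * c n ≤ 2 * c (n + 1) := by
    intro n hn
    obtain ⟨k, rfl⟩ : ∃ k, n = k + 1 := ⟨n - 1, by omega⟩
    obtain ⟨hle, hratio, -⟩ := growth_of_recurrence hr hc0 hc1 hcrec k
    exact ⟨by push_cast; linarith, hratio⟩
  have hsides : ∀ n : ℕ, 2 ≤ n → (n : ℤ) - 2 ≤ α * c n + β * c (n - 1) ∧
      5 * (α * c n + β * c (n - 1)) ≤ 2 * (α * c (n + 1) + β * c n) := by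
    intro n hn
    obtain ⟨hle, hratio⟩ := hgrowth n (by omega)
    obtain ⟨hle', hratio'⟩ := hgrowth (n - 1) (by omega)
    rw [Nat.sub_add_cancel (by omega)] at hratio'
    push_cast [show 1 ≤ n by omega] at hle'
    have hα : (0 : ℤ) ≤ α := Nat.cast_nonneg α
    have hβ : (0 : ℤ) ≤ β := Nat.cast_nonneg β
    have hsum : (1 : ℤ) ≤ α + β := by
      have : ¬ (α = 0 ∧ β = 0) := by simpa using hαβ
      omega
    have hn' : (2 : ℤ) ≤ n := by exact_mod_cast hn
    constructor
    · nlinarith [mul_nonneg hα (show 0 ≤ c n - (n - 2) by linarith),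
        mul_nonneg hβ (show 0 ≤ c (n - 1) - (n - 2) by linarith),
        mul_nonneg (sub_nonneg.mpr hsum) (sub_nonneg.mpr hn')]
    · nlinarith [mul_nonneg hα (sub_nonneg.mpr hratio), mul_nonneg hβ (sub_nonneg.mpr hratio')]
  have hheight : Filter.Tendsto (fun n : ℕ => (α * c n + β * c (n - 1)).toNat)
      Filter.atTop Filter.atTop := by
    refine Filter.tendsto_atTop_mono' _ ?_ (Filter.tendsto_sub_atTop_nat 2)
    filter_upwards [Filter.eventually_ge_atTop 2] with n hn
    have := (hsides n hn).1
    omega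
  have hlower : Filter.Tendsto
      (fun n : ℕ => 1 - (243 / 256 : ℝ) ^ (α * c n + β * c (n - 1)).toNat)
      Filter.atTop (nhds 1) := by
    simpa using ((tendsto_pow_atTop_nhds_zero_of_lt_one (r := (243 / 256 : ℝ))
      (by norm_num) (by norm_num)).comp hheight).const_sub 1
  refine tendsto_of_tendsto_of_tendsto_of_le_of_le' hlower tendsto_const_nhds ?_ ?_
  · filter_upwards [Filter.eventually_ge_atTop 2] with n hn
    obtain ⟨hle, hratio⟩ := hsides n hn
    have hwidth : ((α * c (n + 1) + β * c n).toNat : ℤ) = α * c (n + 1) + β * c n :=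
      Int.toNat_of_nonneg (by omega)
    have := one_sub_pow_le_ratio hr (ℓ := (α * c (n + 1) + β * c n).toNat)
      (h := (α * c n + β * c (n - 1)).toNat) (by omega)
    rwa [hwidth] at this
  · refine Filter.Eventually.of_forall fun n => div_le_one_of_le₀ ?_ (Nat.cast_nonneg _)
    exact_mod_cast Finset.card_filter_le _ _
end

section
/- Fix an integer r ≥ 3 and an integer n ≥ 3, and let P = P(c(n+1), c n). Let CP_bad(P) be the set of compatible pairs (S_1,S_2) on P with r·|S_2| > c(n+1). Then |CP_bad(P)| ≤ 2^{c(n+1) − (r−1)·(c n − c(n−2))} · Σ_{k=0}^{c(n−2)} C(c n, k), where C(·,·) denotes the ordinary binomial coefficient. -/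
namespace CPwork

theorem northBefore_lt_iff {ℓ h i j : ℕ} (hℓ : 0 < ℓ) : northBefore ℓ h i < j ↔ i * h < j * ℓ :=
  Nat.div_lt_iff_lt_mul hℓ

theorem le_northBefore_iff {ℓ h i j : ℕ} (hℓ : 0 < ℓ) : j ≤ northBefore ℓ h i ↔ j * ℓ ≤ i * h :=
  Nat.le_div_iff_mul_le hℓ

theorem northBefore_mono (ℓ h : ℕ) : Monotone (northBefore ℓ h) := fun _ _ hij =>
  Nat.div_le_div_right (Nat.mul_le_mul_right h hij)

theorem eastBefore_mono (ℓ h : ℕ) : Monotone (eastBefore ℓ h) := fun _ _ hjk =>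
  Finset.card_le_card (Finset.monotone_filter_right _ fun _ _ hi => lt_of_lt_of_le hi hjk)

theorem le_eastBefore {ℓ h i j : ℕ} (hi : i ≤ ℓ) (hij : northBefore ℓ h i < j) :
    i ≤ eastBefore ℓ h j := by
  have hsub : Finset.Icc 1 i ⊆ (Finset.Icc 1 ℓ).filter fun k => northBefore ℓ h k < j := by
    intro k hk
    rw [Finset.mem_Icc] at hk
    rw [Finset.mem_filter, Finset.mem_Icc]
    exact ⟨⟨hk.1, hk.2.trans hi⟩, (northBefore_mono ℓ h hk.2).trans_lt hij⟩
  simpa [eastBefore] using Finset.card_le_card hsub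

theorem eastBefore_le {ℓ h i j : ℕ} (hij : j ≤ northBefore ℓ h i) :
    eastBefore ℓ h j ≤ i - 1 := by
  have hsub : ((Finset.Icc 1 ℓ).filter fun k => northBefore ℓ h k < j) ⊆ Finset.Icc 1 (i - 1) := by
    intro k hk
    rw [Finset.mem_filter, Finset.mem_Icc] at hk
    rw [Finset.mem_Icc]
    have : k < i := by
      by_contra hki
      have := northBefore_mono ℓ h (not_lt.mp hki)
      omega
    omega
  simpa [eastBefore] using Finset.card_le_card hsub

/-- In a compatible pair, no horizontal edge of `S1` lies in the row directly below a vertical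
edge of `S2`, provided that no row has more than `R` horizontal edges. -/
theorem Compatible.northBefore_add_one_notMem {R ℓ h : ℕ} {S1 S2 : Finset ℕ}
    (hR : 0 < R) (hℓ : 0 < ℓ) (hℓh : ℓ ≤ R * h) (hcomp : Compatible R ℓ h S1 S2)
    {i : ℕ} (hi : i ∈ S1) : northBefore ℓ h i + 1 ∉ S2 := by
  obtain ⟨hS1, -, hpair⟩ := hcomp
  intro hj
  have hi' := Finset.mem_Icc.mp (hS1 hi)
  obtain ⟨m, hm, hma, hmb, hor⟩ := hpair i hi _ hj
  set N := northBefore ℓ h i with hN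
  have hiE : i ≤ eastBefore ℓ h (N + 1) := le_eastBefore hi'.2 (Nat.lt_succ_self _)
  have ha : pE ℓ h i = i + N - 1 := rfl
  have hb : pN ℓ h (N + 1) = N + 1 + eastBefore ℓ h (N + 1) := rfl
  have hab : pE ℓ h i ≤ pN ℓ h (N + 1) := by omega
  rw [pts, if_pos hab, Finset.mem_Icc] at hm
  rw [steps, if_pos hm.2, steps, if_pos hm.1] at hor
  rcases hor with hor | hor
  · have hV : 1 ≤ vInS ℓ h S2 (Finset.Icc (m + 1) (pN ℓ h (N + 1))) := by
      refine Finset.card_pos.mpr ⟨N + 1, Finset.mem_filter.mpr ⟨hj, Finset.mem_Icc.mpr ?_⟩⟩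
      change m + 1 ≤ pN ℓ h (N + 1) ∧ pN ℓ h (N + 1) ≤ _
      omega
    have hH : hIn ℓ h (Finset.Icc (m + 1) (pN ℓ h (N + 1))) ≤ R - 1 := by
      have hsub : ((Finset.Icc 1 ℓ).filter fun k =>
          posE ℓ h k ∈ Finset.Icc (m + 1) (pN ℓ h (N + 1))) ⊆ Finset.Ioo i (i + R) := by
        intro k hk
        rw [Finset.mem_filter, Finset.mem_Icc, Finset.mem_Icc, posE] at hk
        rw [Finset.mem_Ioo]
        have hik : i < k := by
          by_contra hki
          have := northBefore_mono ℓ h (not_lt.mp hki)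
          omega
        have hkN : northBefore ℓ h k < N + 1 := by
          by_contra hcon
          have := eastBefore_le (not_lt.mp hcon)
          omega
        refine ⟨hik, ?_⟩
        rw [northBefore_lt_iff hℓ] at hkN
        have hiN := (le_northBefore_iff hℓ).mp hN.le
        by_contra hcon
        have := Nat.mul_le_mul_right h (not_lt.mp hcon)
        nlinarith
      refine (Finset.card_le_card hsub).trans ?_
      rw [Nat.card_Ioo]
      omega
    have hor' : hIn ℓ h (Finset.Icc (m + 1) (pN ℓ h (N + 1)))
        = R * vInS ℓ h S2 (Finset.Icc (m + 1) (pN ℓ h (N + 1))) := by exact_mod_cast hor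
    have := Nat.mul_le_mul_left R hV
    omega
  · have hH : 1 ≤ hInS ℓ h S1 (Finset.Icc (pE ℓ h i + 1) m) := by
      refine Finset.card_pos.mpr ⟨i, Finset.mem_filter.mpr ⟨hi, Finset.mem_Icc.mpr ?_⟩⟩
      rw [posE]
      omega
    have hV : vIn ℓ h (Finset.Icc (pE ℓ h i + 1) m) = 0 := by
      refine Finset.card_eq_zero.mpr (Finset.filter_eq_empty_iff.mpr fun k _ hk => ?_)
      rw [Finset.mem_Icc, posN] at hk
      rcases le_or_gt k N with hkN | hkN
      · have := eastBefore_le (hkN.trans hN.le)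
        omega
      · have := eastBefore_mono ℓ h (show N + 1 ≤ k from hkN)
        omega
    have hor' : vIn ℓ h (Finset.Icc (pE ℓ h i + 1) m)
        = R * hInS ℓ h S1 (Finset.Icc (pE ℓ h i + 1) m) := by exact_mod_cast hor
    have := Nat.mul_le_mul_left R hH
    omega

/-- The horizontal edges lying in a row directly below a vertical edge of `S2`. -/
def rowsBelow (ℓ h : ℕ) (S2 : Finset ℕ) : Finset ℕ :=
  (Finset.Icc 1 ℓ).filter fun i => northBefore ℓ h i + 1 ∈ S2

/-- If every row has at least `q` horizontal edges, then the rows below `S2` contain at least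
`q * |S2|` of them. -/
theorem mul_card_le_card_rowsBelow {q ℓ h : ℕ} (hh : 0 < h) (hq : q * h < ℓ) {S2 : Finset ℕ}
    (hS2 : S2 ⊆ Finset.Icc 1 h) : q * S2.card ≤ (rowsBelow ℓ h S2).card := by
  have hℓ : 0 < ℓ := by omega
  refine Finset.mul_card_image_le_card_of_maps_to (f := fun i => northBefore ℓ h i + 1)
    (fun i hi => (Finset.mem_filter.mp hi).2) q fun j hj => ?_
  have hj' := Finset.mem_Icc.mp (hS2 hj)
  obtain ⟨k, rfl⟩ : ∃ k, j = k + 1 := ⟨j - 1, by omega⟩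
  have hsub : Finset.Ioc (k * ℓ / h) (k * ℓ / h + q) ⊆
      (rowsBelow ℓ h S2).filter fun i => northBefore ℓ h i + 1 = k + 1 := by
    intro i hi
    rw [Finset.mem_Ioc] at hi
    have hlow : k * ℓ < i * h := (Nat.div_lt_iff_lt_mul hh).mp hi.1
    have hup : i * h < (k + 1) * ℓ := by
      have h1 := Nat.mul_le_mul_right h hi.2
      have h2 := Nat.div_mul_le_self (k * ℓ) h
      nlinarith
    have hNi : northBefore ℓ h i = k := by
      have h1 := (northBefore_lt_iff hℓ).mpr hup
      have h2 := (le_northBefore_iff hℓ).mpr hlow.le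
      omega
    have hiℓ : i ≤ ℓ := by
      by_contra hcon
      have h1 := Nat.mul_le_mul_right h (not_le.mp hcon).le
      have h2 := Nat.mul_le_mul_right ℓ hj'.2
      nlinarith
    rw [Finset.mem_filter, rowsBelow, Finset.mem_filter, Finset.mem_Icc, hNi]
    exact ⟨⟨⟨Nat.one_le_of_lt hi.1, hiℓ⟩, hj⟩, rfl⟩
  simpa [rowsBelow] using Finset.card_le_card hsub

theorem card_filter_powerset_le_sum_choose (h K : ℕ) (hK : K ≤ h) :
    ((Finset.Icc 1 h).powerset.filter fun S => h - K ≤ S.card).card ≤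
      ∑ k ∈ Finset.range (K + 1), h.choose k := by
  have hsub : ((Finset.Icc 1 h).powerset.filter fun S => h - K ≤ S.card) ⊆
      (Finset.range (K + 1)).biUnion fun k => (Finset.Icc 1 h).powersetCard (h - k) := by
    intro S hS
    rw [Finset.mem_filter, Finset.mem_powerset] at hS
    have hcard : S.card ≤ h := by simpa using Finset.card_le_card hS.1
    rw [Finset.mem_biUnion]
    exact ⟨h - S.card, Finset.mem_range.mpr (by omega),
      Finset.mem_powersetCard.mpr ⟨hS.1, by omega⟩⟩
  refine (Finset.card_le_card hsub).trans (Finset.card_biUnion_le.trans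
    (Finset.sum_le_sum fun k hk => ?_))
  rw [Finset.mem_range] at hk
  rw [Finset.card_powersetCard, Nat.card_Icc, Nat.add_sub_cancel, Nat.choose_symm (by omega)]

/-- If every row of `P(ℓ,h)` has at least `q` and at most `R` horizontal edges, there are few
compatible pairs whose second component misses at most `K` vertical edges. -/
theorem card_filter_CP_le {R q ℓ h K : ℕ} (hR : 0 < R) (hh : 0 < h) (hq : q * h < ℓ)
    (hℓh : ℓ ≤ R * h) (hK : K ≤ h) :
    ((CP R ℓ h).filter fun p => h - K ≤ p.2.card).card ≤
      2 ^ (ℓ - q * (h - K)) * ∑ k ∈ Finset.range (K + 1), h.choose k := by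
  classical
  have hℓ : 0 < ℓ := by omega
  have hsub : ((CP R ℓ h).filter fun p => h - K ≤ p.2.card) ⊆
      ((Finset.Icc 1 h).powerset.filter fun S => h - K ≤ S.card).biUnion fun S2 =>
        (Finset.Icc 1 ℓ \ rowsBelow ℓ h S2).powerset ×ˢ {S2} := by
    rintro ⟨S1, S2⟩ hp
    simp only [CP, Finset.mem_filter, Finset.mem_product, Finset.mem_powerset] at hp
    obtain ⟨⟨⟨hS1, hS2⟩, hcomp⟩, hcard⟩ := hp
    simp only [Finset.mem_biUnion, Finset.mem_filter, Finset.mem_powerset, Finset.mem_product,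
      Finset.mem_singleton]
    refine ⟨S2, ⟨hS2, hcard⟩, fun i hi => Finset.mem_sdiff.mpr ⟨hS1 hi, fun hrow => ?_⟩, rfl⟩
    exact hcomp.northBefore_add_one_notMem hR hℓ hℓh hi (Finset.mem_filter.mp hrow).2
  refine (Finset.card_le_card hsub).trans ?_
  refine (Finset.card_biUnion_le_card_mul _ _ (2 ^ (ℓ - q * (h - K))) fun S2 hS2 => ?_).trans ?_
  · rw [Finset.mem_filter, Finset.mem_powerset] at hS2
    rw [Finset.card_product, Finset.card_singleton, mul_one, Finset.card_powerset]
    refine Nat.pow_le_pow_right two_pos ?_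
    rw [Finset.card_sdiff_of_subset (show rowsBelow ℓ h S2 ⊆ _ from Finset.filter_subset _ _),
      Nat.card_Icc]
    have h1 := mul_card_le_card_rowsBelow hh hq hS2.1
    have h2 := Nat.mul_le_mul_left q hS2.2
    omega
  · rw [mul_comm]
    exact Nat.mul_le_mul_left _ (card_filter_powerset_le_sum_choose h K hK)

end CPwork

/-- A sequence with `c (n + 1) = r * c n - c (n - 1)`, where `r ≥ 2`, that starts with `-1, 0`
is nonnegative from index one on, and strictly increasing. -/
theorem nonneg_and_lt_succ_of_recurrence {r : ℤ} (hr : 2 ≤ r) {c : ℕ → ℤ}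
    (hc0 : c 0 = -1) (hc1 : c 1 = 0)
    (hcrec : ∀ n, 1 ≤ n → c (n + 1) = r * c n - c (n - 1)) (n : ℕ) :
    0 ≤ c (n + 1) ∧ c n < c (n + 1) := by
  induction n with
  | zero => simp [hc0, hc1]
  | succ k ih =>
    have hrec := hcrec (k + 1) (by omega)
    rw [Nat.add_sub_cancel] at hrec
    constructor <;> nlinarith

open CPwork in
/-- Fix `r ≥ 3` and `n ≥ 3`, and let `P = P(c(n+1), c n)`.  Let `CP_bad(P)` be the set
of compatible pairs `(S₁,S₂)` on `P` with `r·|S₂| > c(n+1)`.  Then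
`|CP_bad(P)| ≤ 2^{c(n+1) − (r−1)·(c n − c(n−2))} · Σ_{k=0}^{c(n−2)} C(c n, k)`,
where `C(·,·)` is the ordinary binomial coefficient. -/
theorem card_bad_compatible_pairs_upper_bound
    (r : ℤ) (hr : 3 ≤ r) (c : ℕ → ℤ)
    (hc0 : c 0 = -1) (hc1 : c 1 = 0)
    (hcrec : ∀ n, 1 ≤ n → c (n + 1) = r * c n - c (n - 1))
    (n : ℕ) (hn : 3 ≤ n) :
    ((((CP r ((c (n + 1)).toNat) ((c n).toNat)).filter
          (fun p => c (n + 1) < r * (p.2.card : ℤ))).card : ℝ)) ≤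
      (2 : ℝ) ^ (c (n + 1) - (r - 1) * (c n - c (n - 2))) *
        ∑ k ∈ Finset.range ((c (n - 2)).toNat + 1), ((c n).toNat.choose k : ℝ) := by
  obtain ⟨k, rfl⟩ : ∃ k, n = k + 3 := ⟨n - 3, by omega⟩
  have hmono := nonneg_and_lt_succ_of_recurrence (by omega) hc0 hc1 hcrec
  obtain ⟨hK0, -⟩ := hmono k
  obtain ⟨-, hlt1⟩ := hmono (k + 1)
  obtain ⟨hh0, hlt2⟩ := hmono (k + 2)
  have hrec1 : c (k + 2) = r * c (k + 1) - c k := hcrec (k + 1) (by omega)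
  have hrec3 : c (k + 3 + 1) = r * c (k + 3) - c (k + 2) := hcrec (k + 3) (by omega)
  have hck : -1 ≤ c k := by
    cases k with
    | zero => exact hc0.ge
    | succ k => linarith [(hmono k).1]
  rw [show k + 3 - 2 = k + 1 by omega]
  obtain ⟨R, rfl⟩ := Int.eq_ofNat_of_zero_le (show 0 ≤ r by omega)
  obtain ⟨K, hK'⟩ := Int.eq_ofNat_of_zero_le hK0
  obtain ⟨h, hh'⟩ := Int.eq_ofNat_of_zero_le hh0
  obtain ⟨ℓ, hℓ'⟩ := Int.eq_ofNat_of_zero_le (hmono (k + 3)).1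
  change c (k + 3) = h at hh'
  change c (k + 1) < c (k + 2) at hlt1
  change c (k + 2) < c (k + 3) at hlt2
  rw [hh', hℓ', hK']
  simp only [Int.toNat_natCast]
  rw [hh', hℓ'] at hrec3
  rw [hh'] at hlt2
  rw [hK'] at hrec1 hlt1
  have hKh : K ≤ h := by omega
  obtain ⟨q, rfl⟩ : ∃ q, R = q + 1 := ⟨R - 1, by omega⟩
  have hq : q * h < ℓ := by
    zify
    push_cast at hrec3
    linarith
  have hℓh : ℓ ≤ (q + 1) * h := by
    zify
    push_cast at hrec3
    linarith
  have hsub : ((CP (q + 1 : ℕ) ℓ h).filter fun p => (ℓ : ℤ) < (q + 1 : ℕ) * (p.2.card : ℤ)) ⊆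
      (CP (q + 1 : ℕ) ℓ h).filter fun p => h - K ≤ p.2.card := by
    refine Finset.monotone_filter_right _ fun p _ hp => ?_
    by_contra hcon
    have hcon' : (p.2.card : ℤ) + 1 + K ≤ h := by omega
    have := mul_le_mul_of_nonneg_left hcon' (show (0 : ℤ) ≤ (q + 1 : ℕ) by omega)
    linarith
  have hexp : ((ℓ - q * (h - K) : ℕ) : ℤ) = ℓ - (((q + 1 : ℕ) : ℤ) - 1) * (h - K) := by
    have : q * (h - K) ≤ ℓ := (Nat.mul_le_mul_left q (Nat.sub_le h K)).trans hq.le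
    push_cast [this, hKh]
    ring
  rw [← hexp, zpow_natCast]
  exact_mod_cast (Finset.card_le_card hsub).trans
    (card_filter_CP_le (Nat.succ_pos q) (by omega) hq hℓh hKh)
end
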